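/- arXiv:1208.5788 — 2 statements merged into one kernel-verified Lean document; each statement's English description precedes it below -/
import Mathlib

section
/- For all integers p ≥ 1 and k with 0 ≤ k ≤ 2p, setting i_k := -2p² - p - 1 + (2p+1)k, the absolute value |⌊i_k/(2p)⌋| equals 1 if k = p or k = p+1, and otherwise |⌊i_k/(2p)⌋| ≥ 2; in particular ⌊i_k/(2p)⌋ is never 0. Moreover ⌊i_p/(2p)⌋ = -1 and ⌊i_{p+1}/(2p)⌋ = 1. -/
/-- The label `i_k` equals `2p(k - p) + (k - p - 1)`; above `p` its quotient by `2p` has floor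
`k - p`. -/
lemma floor_label_of_lt {p k : ℤ} (hp : 1 ≤ p) (hk : p < k) (hk' : k ≤ 2 * p) :
    ⌊(-2 * (p : ℚ) ^ 2 - p - 1 + (2 * p + 1) * k) / (2 * p)⌋ = k - p := by
  have hpos : (0 : ℚ) < 2 * p := by exact_mod_cast (by omega : 0 < 2 * p)
  have h₁ : (p : ℚ) + 1 ≤ k := by exact_mod_cast hk
  have h₂ : (k : ℚ) ≤ 2 * p := by exact_mod_cast hk'
  rw [Int.floor_eq_iff, le_div_iff₀ hpos, div_lt_iff₀ hpos]
  push_cast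
  constructor <;> linarith

/-- Up to `p`, the quotient of the label `i_k` by `2p` has floor `k - p - 1`. -/
lemma floor_label_of_le {p k : ℤ} (hp : 1 ≤ p) (hk : 0 ≤ k) (hk' : k ≤ p) :
    ⌊(-2 * (p : ℚ) ^ 2 - p - 1 + (2 * p + 1) * k) / (2 * p)⌋ = k - p - 1 := by
  have hp' : (1 : ℚ) ≤ p := by exact_mod_cast hp
  have hpos : (0 : ℚ) < 2 * p := by linarith
  have h₁ : (0 : ℚ) ≤ k := by exact_mod_cast hk
  have h₂ : (k : ℚ) ≤ p := by exact_mod_cast hk'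
  rw [Int.floor_eq_iff, le_div_iff₀ hpos, div_lt_iff₀ hpos]
  push_cast
  constructor <;> linarith

/-- For integers `p ≥ 1` and `0 ≤ k ≤ 2p`, with `i_k := -2p² - p - 1 + (2p+1)k`,
the absolute value `|⌊i_k/(2p)⌋|` equals `1` if `k = p` or `k = p+1`, and otherwise is `≥ 2`;
in particular `⌊i_k/(2p)⌋ ≠ 0`.  Moreover `⌊i_p/(2p)⌋ = -1` and `⌊i_{p+1}/(2p)⌋ = 1`. -/
theorem floor_label_abs (p : ℤ) (hp : 1 ≤ p) :
    (∀ k : ℤ, 0 ≤ k → k ≤ 2 * p →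
      ((k = p ∨ k = p + 1) →
        |⌊(-2 * (p : ℚ) ^ 2 - p - 1 + (2 * p + 1) * k) / (2 * p)⌋| = 1) ∧
      ((k ≠ p ∧ k ≠ p + 1) →
        2 ≤ |⌊(-2 * (p : ℚ) ^ 2 - p - 1 + (2 * p + 1) * k) / (2 * p)⌋|) ∧
      ⌊(-2 * (p : ℚ) ^ 2 - p - 1 + (2 * p + 1) * k) / (2 * p)⌋ ≠ 0) ∧
    ⌊(-2 * (p : ℚ) ^ 2 - p - 1 + (2 * p + 1) * p) / (2 * p)⌋ = -1 ∧
    ⌊(-2 * (p : ℚ) ^ 2 - p - 1 + (2 * p + 1) * (p + 1)) / (2 * p)⌋ = 1 := by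
  refine ⟨fun k hk hk' => ?_, ?_, ?_⟩
  · rcases le_or_gt k p with h | h
    · rw [floor_label_of_le hp hk h, abs_of_neg (by omega)]
      omega
    · rw [floor_label_of_lt hp h hk', abs_of_pos (by omega)]
      omega
  · rw [floor_label_of_le hp (by omega) le_rfl]
    omega
  · have h := floor_label_of_lt hp (lt_add_one p) (by omega)
    push_cast at h
    rw [h]
    omega
end

section
/- Let R = (ℤ/2ℤ)[U, U⁻¹] be the ring of Laurent polynomials over the field with two elements. Let (C, ∂) be a chain complex of R-modules that decomposes as a direct sum of subcomplexes C = C' ⊕ A, where A is acyclic (H_n(A) = 0 for all n). Let S ⊆ C be a subcomplex of R-submodules compatible with the splitting, i.e. S_n = (S_n ∩ C'_n) ⊕ (S_n ∩ A_n) for all n, let Q = C/S be the quotient complex with induced differential ∂_Q, and let π : C → Q denote the quotient chain map. Suppose a ∈ A_n is an element such that π(a) is a cycle in Q_n, and suppose there exist an integer k ≥ 0 and a cycle B ∈ C_n (∂B = 0) such that π(U^k·B) and π(a) represent the same homology class in H_n(Q). Then the homology class of π(a) in H_n(Q) is zero. -/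
theorem exists_add_eq_of_isCompl {R M : Type*} [Ring R] [AddCommGroup M] [Module R M]
    {P Q : Submodule R M} (h : IsCompl P Q) (x : M) : ∃ p ∈ P, ∃ q ∈ Q, p + q = x :=
  Submodule.mem_sup.mp (h.sup_eq_top ▸ Submodule.mem_top)

/-- A submodule compatible with a splitting contains the components of its elements. -/
theorem right_mem_of_add_mem {R M : Type*} [Ring R] [AddCommGroup M] [Module R M]
    {P Q S : Submodule R M} (hPQ : Disjoint P Q) (hS : S = (S ⊓ P) ⊔ (S ⊓ Q))
    {p q : M} (hp : p ∈ P) (hq : q ∈ Q) (h : p + q ∈ S) : q ∈ S := by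
  rw [hS] at h
  obtain ⟨p₁, hp₁, q₁, hq₁, heq⟩ := Submodule.mem_sup.mp h
  have hsub : q - q₁ = p₁ - p := by
    rw [sub_eq_sub_iff_add_eq_add, heq, add_comm]
  have hzero : q - q₁ = 0 := Submodule.disjoint_def.mp hPQ _
    (hsub ▸ sub_mem hp₁.2 hp) (sub_mem hq hq₁.2)
  exact sub_eq_zero.mp hzero ▸ hq₁.1

open LaurentPolynomial in
/-- Let `R = (ℤ/2ℤ)[U,U⁻¹]` (Laurent polynomials, with `U = T 1`).  Let `(C, d)` be a chain
complex of `R`-modules that splits as an internal direct sum of subcomplexes `C = C' ⊕ A`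
with `A` acyclic.  Let `S` be a subcomplex compatible with the splitting, i.e.
`S n = (S n ⊓ C' n) ⊔ (S n ⊓ A n)`, and let `Q = C/S` be the quotient complex.
If `a ∈ A` is an element whose image in `Q` is a cycle, and there are `k : ℕ` and a cycle `B`
in `C` such that the images of `U^k • B` and `a` in `Q` represent the same homology class
(i.e. their difference is a boundary of `Q`), then the homology class of the image of `a` in
the quotient complex is zero (i.e. `a` maps to a boundary of `Q`).

Here the degree of `a` is written as `n - 1`, so that boundaries into its degree come from
degree `n`; membership `x - d n y ∈ S (n - 1)` says exactly that the images of `x` and `d n y`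
in `Q (n-1) = C (n-1) ⧸ S (n-1)` agree. -/
theorem acyclic_summand_no_contribution
    (C : ℤ → Type) [∀ n, AddCommGroup (C n)]
    [∀ n, Module (LaurentPolynomial (ZMod 2)) (C n)]
    -- the differential of the chain complex `C`
    (d : ∀ n : ℤ, C n →ₗ[LaurentPolynomial (ZMod 2)] C (n - 1))
    (hdd : ∀ (n : ℤ) (x : C n), d (n - 1) (d n x) = 0)
    -- the splitting `C = C' ⊕ A` into subcomplexes
    (C' A : ∀ n : ℤ, Submodule (LaurentPolynomial (ZMod 2)) (C n))
    (hsplit : ∀ n : ℤ, IsCompl (C' n) (A n))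
    (hC'sub : ∀ n : ℤ, ∀ x ∈ C' n, d n x ∈ C' (n - 1))
    (hAsub : ∀ n : ℤ, ∀ x ∈ A n, d n x ∈ A (n - 1))
    -- `A` is acyclic: every cycle of `A` bounds in `A`
    (hAacyclic : ∀ (n : ℤ) (x : C (n - 1)), x ∈ A (n - 1) → d (n - 1) x = 0 →
      ∃ y : C n, y ∈ A n ∧ d n y = x)
    -- the subcomplex `S`, compatible with the splitting
    (S : ∀ n : ℤ, Submodule (LaurentPolynomial (ZMod 2)) (C n))
    (hSsub : ∀ n : ℤ, ∀ x ∈ S n, d n x ∈ S (n - 1))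
    (hScompat : ∀ n : ℤ, S n = (S n ⊓ C' n) ⊔ (S n ⊓ A n))
    -- the element `a` of `A`, whose image in `Q = C/S` is a cycle
    (n : ℤ) (a : C (n - 1)) (ha : a ∈ A (n - 1))
    (hacycle : d (n - 1) a ∈ S (n - 1 - 1))
    -- a cycle `B` of `C` with `[π (U^k • B)] = [π a]` in `H (Q)`
    (k : ℕ) (B : C (n - 1)) (hBcycle : d (n - 1) B = 0)
    (hsameclass : ∃ x : C n, (T 1 : LaurentPolynomial (ZMod 2)) ^ k • B - a - d n x ∈ S (n - 1)) :
    -- conclusion: the image of `a` in `Q` is a boundary, i.e. `[π a] = 0` in `H (Q)`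
    ∃ y : C n, a - d n y ∈ S (n - 1) := by
  obtain ⟨x, hx⟩ := hsameclass
  obtain ⟨B', hB', B₀, hB₀, rfl⟩ := exists_add_eq_of_isCompl (hsplit (n - 1)) B
  obtain ⟨x', hx', x₀, hx₀, rfl⟩ := exists_add_eq_of_isCompl (hsplit n) x
  have hdB₀ : d (n - 1) B₀ = 0 := by
    have h : d (n - 1) B' + d (n - 1) B₀ ∈ (⊥ : Submodule (LaurentPolynomial (ZMod 2)) _) := by
      simpa using hBcycle
    simpa using right_mem_of_add_mem (hsplit _).disjoint (by simp)
      (hC'sub _ _ hB') (hAsub _ _ hB₀) h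
  obtain ⟨y, -, rfl⟩ := hAacyclic n B₀ hB₀ hdB₀
  have hmem : (T 1 : LaurentPolynomial (ZMod 2)) ^ k • d n y - a - d n x₀ ∈ S (n - 1) := by
    refine right_mem_of_add_mem (hsplit _).disjoint (hScompat _)
      (sub_mem (Submodule.smul_mem _ ((T 1 : LaurentPolynomial (ZMod 2)) ^ k) hB')
        (hC'sub _ _ hx'))
      (sub_mem (sub_mem (Submodule.smul_mem _ _ hB₀) ha) (hAsub _ _ hx₀)) ?_
    convert hx using 1
    rw [smul_add, map_add]
    abel
  refine ⟨(T 1 : LaurentPolynomial (ZMod 2)) ^ k • y - x₀, ?_⟩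
  convert neg_mem hmem using 1
  rw [map_sub, map_smul]
  abel
end
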